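/- arXiv:2603.15912 — 2 statements merged into one kernel-verified Lean document; each statement's English description precedes it below -/
import Mathlib

section
/- Let ψ, ψ̂ ∈ ℝ^{n×(n+m)}, g ∈ ℝ^{n+m}, d ∈ ℝ^n, and κ ∈ ℝ. Let x = ψ g + d, ε = x − ψ̂ g, and ψ̄ = ψ̂ + κ ε gᵀ/(1 + gᵀg). Then ‖ψ̄ − ψ‖_F² ≤ ‖ψ̂ − ψ‖_F² − κ(2−κ) ‖ε‖₂²/(1 + gᵀg) + 2κ ⟨d, ε⟩/(1 + gᵀg), where ⟨·,·⟩ is the Euclidean inner product on ℝ^n. -/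
open Matrix

/-- Squared Frobenius norm of a real matrix. -/
noncomputable def frobSq {n p : ℕ} (M : Matrix (Fin n) (Fin p) ℝ) : ℝ :=
  ∑ i, ∑ j, (M i j) ^ 2

/-- The squared Frobenius norm of a rank-one perturbation. -/
theorem frobSq_add_smul_vecMulVec {n p : ℕ} (M : Matrix (Fin n) (Fin p) ℝ) (c : ℝ)
    (a : Fin n → ℝ) (b : Fin p → ℝ) :
    frobSq (M + c • vecMulVec a b) =
      frobSq M + 2 * c * (a ⬝ᵥ M.mulVec b) + c ^ 2 * ((a ⬝ᵥ a) * (b ⬝ᵥ b)) := by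
  simp only [frobSq, dotProduct, mulVec, Finset.sum_mul_sum]
  simp only [Finset.mul_sum, ← Finset.sum_add_distrib, Matrix.add_apply, Matrix.smul_apply,
    vecMulVec_apply, smul_eq_mul]
  refine Finset.sum_congr rfl fun i _ => Finset.sum_congr rfl fun j _ => ?_
  ring

/-- For `x = ψ g + d`, `ε = x − ψ̂ g`, and
`ψ̄ = ψ̂ + κ ε gᵀ/(1 + gᵀg)`, one has
`‖ψ̄ − ψ‖_F² ≤ ‖ψ̂ − ψ‖_F² − κ(2−κ)‖ε‖₂²/(1 + gᵀg) + 2κ⟨d, ε⟩/(1 + gᵀg)`. -/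
theorem stmt3 {n m : ℕ}
    (ψ ψhat : Matrix (Fin n) (Fin (n + m)) ℝ)
    (g : Fin (n + m) → ℝ) (d : Fin n → ℝ) (κ : ℝ)
    (x : Fin n → ℝ) (hx : x = ψ.mulVec g + d)
    (ε : Fin n → ℝ) (hε : ε = x - ψhat.mulVec g)
    (ψbar : Matrix (Fin n) (Fin (n + m)) ℝ)
    (hψbar : ψbar = ψhat + (κ / (1 + g ⬝ᵥ g)) • Matrix.vecMulVec ε g) :
    frobSq (ψbar - ψ) ≤
      frobSq (ψhat - ψ) - κ * (2 - κ) * (ε ⬝ᵥ ε) / (1 + g ⬝ᵥ g)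
        + 2 * κ * (d ⬝ᵥ ε) / (1 + g ⬝ᵥ g) := by
  have hresidual : (ψhat - ψ).mulVec g = d - ε := by
    rw [hε, hx, sub_mulVec]
    abel
  have hg : 0 ≤ g ⬝ᵥ g := Finset.sum_nonneg fun i _ => mul_self_nonneg (g i)
  have hε_nonneg : 0 ≤ ε ⬝ᵥ ε := Finset.sum_nonneg fun i _ => mul_self_nonneg (ε i)
  have hpos : 0 < 1 + g ⬝ᵥ g := by linarith
  rw [hψbar, add_sub_right_comm, frobSq_add_smul_vecMulVec, hresidual, dotProduct_sub,
    dotProduct_comm ε d]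
  have hgap : 0 ≤ (κ / (1 + g ⬝ᵥ g)) ^ 2 * (ε ⬝ᵥ ε) := by positivity
  have hsplit : κ * (2 - κ) * (ε ⬝ᵥ ε) / (1 + g ⬝ᵥ g) =
      2 * (κ / (1 + g ⬝ᵥ g)) * (ε ⬝ᵥ ε) -
        (κ / (1 + g ⬝ᵥ g)) ^ 2 * ((ε ⬝ᵥ ε) * (g ⬝ᵥ g)) -
        (κ / (1 + g ⬝ᵥ g)) ^ 2 * (ε ⬝ᵥ ε) := by
    field_simp
    ring
  have hcross : 2 * κ * (d ⬝ᵥ ε) / (1 + g ⬝ᵥ g) =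
      2 * (κ / (1 + g ⬝ᵥ g)) * (d ⬝ᵥ ε) := by ring
  rw [hsplit, hcross]
  linarith
end

section
/- Let ψ ∈ ℝ^{n×(n+m)}, κ ∈ (0,2), and d̄ ≥ 0. Let g_t ∈ ℝ^{n+m} and d_t ∈ ℝ^n be sequences with ‖d_t‖₂ ≤ d̄ √(1 + g_tᵀ g_t) for all t ≥ 0, and let x_t = ψ g_{t−1} + d_{t−1} for t ≥ 1. Let ψ̂_0 ∈ ℝ^{n×(n+m)}, and for t ≥ 1 define ε_t = x_t − ψ̂_{t−1} g_{t−1}, ψ̄_t = ψ̂_{t−1} + κ ε_t g_{t−1}ᵀ/(1 + g_{t−1}ᵀ g_{t−1}), and let ψ̂_t ∈ ℝ^{n×(n+m)} be any matrix satisfying ‖ψ̂_t − ψ‖_F ≤ ‖ψ̄_t − ψ‖_F (e.g., the metric projection of ψ̄_t in Frobenius norm onto a closed convex set containing ψ). Then for every T ≥ 1: ∑_{t=1}^{T} ‖ε_t‖₂²/(1 + g_{t−1}ᵀ g_{t−1}) ≤ (2/(κ(2−κ))) ‖ψ̂_0 − ψ‖_F² + (4/(2−κ)²) d̄² T. -/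
open Matrix

/-- Frobenius norm of a real matrix. -/
noncomputable def frobNorm {n p : ℕ} (M : Matrix (Fin n) (Fin p) ℝ) : ℝ :=
  Real.sqrt (∑ i, ∑ j, (M i j) ^ 2)

/-- Euclidean (2-)norm of a real vector. -/
noncomputable def vecNorm {p : ℕ} (v : Fin p → ℝ) : ℝ :=
  Real.sqrt (∑ i, (v i) ^ 2)

theorem frobNorm_sq {n p : ℕ} (M : Matrix (Fin n) (Fin p) ℝ) :
    frobNorm M ^ 2 = ∑ i, ∑ j, (M i j) ^ 2 :=
  Real.sq_sqrt (Finset.sum_nonneg fun _ _ => Finset.sum_nonneg fun _ _ => sq_nonneg _)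

theorem vecNorm_sq {p : ℕ} (v : Fin p → ℝ) : vecNorm v ^ 2 = ∑ i, (v i) ^ 2 :=
  Real.sq_sqrt (Finset.sum_nonneg fun _ _ => sq_nonneg _)

theorem one_add_dotProduct_self_pos {p : ℕ} (g : Fin p → ℝ) : 0 < 1 + g ⬝ᵥ g := by
  have h : 0 ≤ g ⬝ᵥ g := Finset.sum_nonneg fun _ _ => mul_self_nonneg _
  linarith

/-- Squared-norm decrease of one row of the parameter error under a normalized gradient step. -/
theorem sum_sq_normalized_step_le {p : ℕ} {κ : ℝ} (hκ0 : 0 < κ) (hκ2 : κ < 2)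
    (r g : Fin p → ℝ) (e δ : ℝ) (he : e = δ - r ⬝ᵥ g) :
    ∑ j, (r j + κ / (1 + g ⬝ᵥ g) * (e * g j)) ^ 2 ≤
      ∑ j, (r j) ^ 2 - κ * (2 - κ) / 2 * (e ^ 2 / (1 + g ⬝ᵥ g))
        + 2 * κ / (2 - κ) * (δ ^ 2 / (1 + g ⬝ᵥ g)) := by
  have hN := one_add_dotProduct_self_pos g
  have hexp : ∀ c : ℝ, ∑ j, (r j + c * (e * g j)) ^ 2 =
      ∑ j, (r j) ^ 2 + 2 * c * e * (r ⬝ᵥ g) + c ^ 2 * e ^ 2 * (g ⬝ᵥ g) := by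
    intro c
    simp only [dotProduct, Finset.mul_sum, ← Finset.sum_add_distrib]
    exact Finset.sum_congr rfl fun j _ => by ring
  have hrg : r ⬝ᵥ g = δ - e := by linarith
  rw [hexp, hrg]
  obtain ⟨N, hNdef⟩ : ∃ N, N = 1 + g ⬝ᵥ g := ⟨_, rfl⟩
  have hG : g ⬝ᵥ g = N - 1 := by linarith
  rw [← hNdef] at hN ⊢
  rw [hG]
  have hκ : 0 < 2 - κ := by linarith
  have hgap : 0 ≤ κ ^ 2 * e ^ 2 / N ^ 2
      + κ / N * (((2 - κ) * e - 2 * δ) ^ 2 / (2 * (2 - κ))) := by positivity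
  have hid : κ ^ 2 * e ^ 2 / N ^ 2 + κ / N * (((2 - κ) * e - 2 * δ) ^ 2 / (2 * (2 - κ))) =
      (- (κ * (2 - κ) / 2 * (e ^ 2 / N)) + 2 * κ / (2 - κ) * (δ ^ 2 / N))
        - (2 * (κ / N) * e * (δ - e) + (κ / N) ^ 2 * e ^ 2 * (N - 1)) := by
    field_simp
    ring
  linarith

/-- Squared Frobenius-norm decrease of the parameter error under a normalized gradient step. -/
theorem frobNorm_sq_normalized_step_le {n p : ℕ} {κ : ℝ} (hκ0 : 0 < κ) (hκ2 : κ < 2)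
    (Θ : Matrix (Fin n) (Fin p) ℝ) (g : Fin p → ℝ) (e δ : Fin n → ℝ)
    (he : e = δ - Θ.mulVec g) :
    frobNorm (Θ + (κ / (1 + g ⬝ᵥ g)) • Matrix.vecMulVec e g) ^ 2 ≤
      frobNorm Θ ^ 2 - κ * (2 - κ) / 2 * ((e ⬝ᵥ e) / (1 + g ⬝ᵥ g))
        + 2 * κ / (2 - κ) * (vecNorm δ ^ 2 / (1 + g ⬝ᵥ g)) := by
  have hee : e ⬝ᵥ e = ∑ i, (e i) ^ 2 := Finset.sum_congr rfl fun i _ => (pow_two (e i)).symm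
  rw [frobNorm_sq, frobNorm_sq, vecNorm_sq, hee]
  simp only [Finset.sum_div, Finset.mul_sum,
    ← Finset.sum_sub_distrib, ← Finset.sum_add_distrib (s := (Finset.univ : Finset (Fin n)))]
  exact Finset.sum_le_sum fun i _ =>
    sum_sq_normalized_step_le hκ0 hκ2 (Θ i) g (e i) (δ i) (by rw [he]; rfl)

/-- With `κ ∈ (0,2)`, `‖d_t‖₂ ≤ d̄ √(1 + g_tᵀg_t)`,
`x_t = ψ g_{t−1} + d_{t−1}`, normalized gradient updates
`ψ̄_t = ψ̂_{t−1} + κ ε_t g_{t−1}ᵀ/(1 + g_{t−1}ᵀg_{t−1})` where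
`ε_t = x_t − ψ̂_{t−1} g_{t−1}`, and any `ψ̂_t` with
`‖ψ̂_t − ψ‖_F ≤ ‖ψ̄_t − ψ‖_F`, the normalized errors satisfy
`∑_{t=1}^{T} ‖ε_t‖₂²/(1 + g_{t−1}ᵀg_{t−1})
  ≤ (2/(κ(2−κ))) ‖ψ̂_0 − ψ‖_F² + (4/(2−κ)²) d̄² T`. -/
theorem stmt6 {n m : ℕ}
    (ψ : Matrix (Fin n) (Fin (n + m)) ℝ)
    (κ : ℝ) (hκ0 : 0 < κ) (hκ2 : κ < 2)
    (dbar : ℝ) (hdbar : 0 ≤ dbar)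
    (g : ℕ → Fin (n + m) → ℝ) (d : ℕ → Fin n → ℝ)
    (hd : ∀ t, vecNorm (d t) ≤ dbar * Real.sqrt (1 + g t ⬝ᵥ g t))
    (x : ℕ → Fin n → ℝ)
    (hx : ∀ t, 1 ≤ t → x t = ψ.mulVec (g (t - 1)) + d (t - 1))
    (ψhat ψbar : ℕ → Matrix (Fin n) (Fin (n + m)) ℝ)
    (ε : ℕ → Fin n → ℝ)
    (hε : ∀ t, 1 ≤ t → ε t = x t - (ψhat (t - 1)).mulVec (g (t - 1)))
    (hψbar : ∀ t, 1 ≤ t → ψbar t = ψhat (t - 1) +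
      (κ / (1 + g (t - 1) ⬝ᵥ g (t - 1))) • Matrix.vecMulVec (ε t) (g (t - 1)))
    (hproj : ∀ t, 1 ≤ t → frobNorm (ψhat t - ψ) ≤ frobNorm (ψbar t - ψ)) :
    ∀ T, 1 ≤ T →
      ∑ t ∈ Finset.Icc 1 T, (ε t ⬝ᵥ ε t) / (1 + g (t - 1) ⬝ᵥ g (t - 1)) ≤
        (2 / (κ * (2 - κ))) * (frobNorm (ψhat 0 - ψ)) ^ 2
          + (4 / (2 - κ) ^ 2) * dbar ^ 2 * T := by
  have hκ : 0 < 2 - κ := by linarith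
  have hstep : ∀ t, κ * (2 - κ) / 2 * ((ε (t + 1) ⬝ᵥ ε (t + 1)) / (1 + g t ⬝ᵥ g t)) ≤
      frobNorm (ψhat t - ψ) ^ 2 - frobNorm (ψhat (t + 1) - ψ) ^ 2
        + 2 * κ / (2 - κ) * dbar ^ 2 := by
    intro t
    have ht : 1 ≤ t + 1 := Nat.le_add_left 1 t
    have he : ε (t + 1) = d t - (ψhat t - ψ).mulVec (g t) := by
      rw [hε _ ht, hx _ ht, Nat.add_sub_cancel, Matrix.sub_mulVec]
      abel
    have hbar : ψbar (t + 1) - ψ = (ψhat t - ψ) +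
        (κ / (1 + g t ⬝ᵥ g t)) • Matrix.vecMulVec (ε (t + 1)) (g t) := by
      rw [hψbar _ ht, Nat.add_sub_cancel]
      abel
    have hdec := frobNorm_sq_normalized_step_le hκ0 hκ2 _ _ _ _ he
    rw [← hbar] at hdec
    have hle : frobNorm (ψhat (t + 1) - ψ) ^ 2 ≤ frobNorm (ψbar (t + 1) - ψ) ^ 2 :=
      pow_le_pow_left₀ (Real.sqrt_nonneg _) (hproj _ ht) 2
    have hN := one_add_dotProduct_self_pos (g t)
    have hdist : vecNorm (d t) ^ 2 / (1 + g t ⬝ᵥ g t) ≤ dbar ^ 2 := by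
      rw [div_le_iff₀ hN]
      have h := pow_le_pow_left₀ (Real.sqrt_nonneg _) (hd t) 2
      rwa [mul_pow, Real.sq_sqrt hN.le] at h
    have hdist' := mul_le_mul_of_nonneg_left hdist (by positivity : 0 ≤ 2 * κ / (2 - κ))
    linarith
  have hsum : ∀ T : ℕ, κ * (2 - κ) / 2 *
      ∑ t ∈ Finset.Icc 1 T, (ε t ⬝ᵥ ε t) / (1 + g (t - 1) ⬝ᵥ g (t - 1)) ≤
      frobNorm (ψhat 0 - ψ) ^ 2 - frobNorm (ψhat T - ψ) ^ 2
        + 2 * κ / (2 - κ) * dbar ^ 2 * T := by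
    intro T
    induction T with
    | zero => simp
    | succ T ih =>
      rw [Finset.sum_Icc_succ_top (Nat.le_add_left 1 T), Nat.add_sub_cancel]
      push_cast
      linarith [hstep T]
  intro T _
  have hc : 0 < κ * (2 - κ) / 2 := by positivity
  refine le_of_mul_le_mul_left ?_ hc
  have hrhs : κ * (2 - κ) / 2 * (2 / (κ * (2 - κ)) * frobNorm (ψhat 0 - ψ) ^ 2
      + 4 / (2 - κ) ^ 2 * dbar ^ 2 * T) =
      frobNorm (ψhat 0 - ψ) ^ 2 + 2 * κ / (2 - κ) * dbar ^ 2 * T := by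
    field_simp
    ring
  linarith [hsum T, sq_nonneg (frobNorm (ψhat T - ψ))]
end
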